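/- arXiv:2308.10336 — 2 statements merged into one kernel-verified Lean document; each statement's English description precedes it below -/
import Mathlib

section
/- On ℝ^(2n+1) with coordinates (t, q^i, p_i), let Π̄ be a smooth compactly supported one-form with components (Π̄_t, Π̄_i, Π̄^i) and H a smooth function. Then the L₂-pairing of Π̄ with the cosymplectic Hamiltonian vector field X^{cs}_H is ∫_{ℝ^(2n+1)} Σ_i (Π̄_i ∂H/∂p_i − Π̄^i ∂H/∂q^i) dλ = ∫_{ℝ^(2n+1)} H · (Σ_i ∂Π̄^i/∂q^i − ∂Π̄_i/∂p_i) dλ; equivalently, ⟨Π̄ ⊗ μ̄, X^{cs}_H⟩_{L₂} = ∫ H (div ♯^{cs}Π̄ − L_{R^τ}⟨Π̄, R^τ⟩) μ̄, which identifies the density f = div ♯^{cs}Π̄ − L_{R^τ}⟨Π̄, R^τ⟩ as the momentum/Poisson map from one-form densities to plasma densities. -/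
open MeasureTheory

noncomputable section

/-- The cosymplectic phase space `ℝ^(2n+1)` with coordinates `(t, q, p)`. -/
abbrev Mcs (n : ℕ) : Type := ℝ × (Fin n → ℝ) × (Fin n → ℝ)

/-- Coordinate direction `∂/∂t` (the Reeb field `R^τ`). -/
def eT (n : ℕ) : Mcs n := (1, 0, 0)

/-- Coordinate direction `∂/∂qⁱ`. -/
def eQ (n : ℕ) (i : Fin n) : Mcs n := (0, Pi.single i 1, 0)

/-- Coordinate direction `∂/∂pᵢ`. -/
def eP (n : ℕ) (i : Fin n) : Mcs n := (0, 0, Pi.single i 1)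

/-- Partial derivative of `F` in the direction `v`. -/
def pd {n : ℕ} (F : Mcs n → ℝ) (v : Mcs n) (x : Mcs n) : ℝ := fderiv ℝ F x v

/-- Coordinate divergence of a vector field on `ℝ^(2n+1)`. -/
def divg {n : ℕ} (X : Mcs n → Mcs n) : Mcs n → ℝ :=
  fun x => fderiv ℝ (fun y => (X y).1) x (eT n)
    + (∑ i, fderiv ℝ (fun y => (X y).2.1 i) x (eQ n i))
    + (∑ i, fderiv ℝ (fun y => (X y).2.2 i) x (eP n i))

/-- The musical map `♯^{cs}` applied to a one-form with components `(Π̄_t, Π̄_i, Π̄ⁱ)`: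
`t`-component `Π̄_t`, `qⁱ`-component `Π̄ⁱ`, `pᵢ`-component `−Π̄_i`. -/
def sharpCs {n : ℕ} (Pb : Mcs n → Mcs n) : Mcs n → Mcs n :=
  fun x => ((Pb x).1, fun i => (Pb x).2.2 i, fun i => - (Pb x).2.1 i)

theorem ibp_aux {n : ℕ} (H g : Mcs n → ℝ) (hH : ContDiff ℝ (⊤ : ℕ∞) H)
    (hg : ContDiff ℝ (⊤ : ℕ∞) g) (hc : HasCompactSupport g) (v : Mcs n) :
    Integrable (fun x => g x * fderiv ℝ H x v) ∧ Integrable (fun x => H x * fderiv ℝ g x v) ∧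
      ∫ x, g x * fderiv ℝ H x v = - ∫ x, H x * fderiv ℝ g x v := by
  have cH : Continuous (fun x => fderiv ℝ H x v) :=
    (hH.continuous_fderiv (by simp)).clm_apply continuous_const
  have cg : Continuous (fun x => fderiv ℝ g x v) :=
    (hg.continuous_fderiv (by simp)).clm_apply continuous_const
  have h1 : Integrable (fun x => g x * fderiv ℝ H x v) :=
    (hg.continuous.mul cH).integrable_of_hasCompactSupport hc.mul_right
  have h2 : Integrable (fun x => H x * fderiv ℝ g x v) :=
    (hH.continuous.mul cg).integrable_of_hasCompactSupport (hc.fderiv_apply ℝ v).mul_left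
  have h3 : Integrable (fun x => H x * g x) :=
    (hH.continuous.mul hg.continuous).integrable_of_hasCompactSupport hc.mul_left
  refine ⟨h1, h2, ?_⟩
  haveI i1 : (volume : Measure ((Fin n → ℝ) × (Fin n → ℝ))).IsAddHaarMeasure :=
    Measure.prod.instIsAddHaarMeasure volume volume
  haveI i2 : (volume : Measure (Mcs n)).IsAddHaarMeasure :=
    Measure.prod.instIsAddHaarMeasure volume volume
  have h := integral_mul_fderiv_eq_neg_fderiv_mul_of_integrable (μ := volume) (f := H) (g := g)
    (v := v) (by simpa only [mul_comm] using h1) h2 h3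
    (fun x _ => hH.differentiable (by simp) x) (fun x _ => hg.differentiable (by simp) x)
  rw [h, neg_neg]
  simp only [mul_comm]

/-- The `L₂`-pairing of a compactly supported one-form `Π̄` with the cosymplectic
Hamiltonian vector field `X^{cs}_H` equals the pairing of `H` against the density
`f = Σᵢ(∂Π̄ⁱ/∂qⁱ − ∂Π̄_i/∂pᵢ) = div ♯^{cs}Π̄ − L_{R^τ}⟨Π̄, R^τ⟩`, identifying `f` as
the momentum/Poisson map from one-form densities to plasma densities. -/
theorem cosymplectic_momentum_map_pairing (n : ℕ) (H : Mcs n → ℝ) (hH : ContDiff ℝ (⊤ : ℕ∞) H)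
    (Pb : Mcs n → Mcs n) (hPb : ContDiff ℝ (⊤ : ℕ∞) Pb) (hPbc : HasCompactSupport Pb) :
    (∫ x : Mcs n, ∑ i, ((Pb x).2.1 i * pd H (eP n i) x - (Pb x).2.2 i * pd H (eQ n i) x)
      = ∫ x : Mcs n, H x * ∑ i, (fderiv ℝ (fun y => (Pb y).2.2 i) x (eQ n i)
          - fderiv ℝ (fun y => (Pb y).2.1 i) x (eP n i)))
  ∧ (∫ x : Mcs n, ∑ i, ((Pb x).2.1 i * pd H (eP n i) x - (Pb x).2.2 i * pd H (eQ n i) x)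
      = ∫ x : Mcs n, H x *
          (divg (sharpCs Pb) x - fderiv ℝ (fun y => (Pb y).1) x (eT n))) := by
  have hq : ∀ i, ContDiff ℝ (⊤ : ℕ∞) (fun y => (Pb y).2.1 i) := fun i => by fun_prop
  have hp : ∀ i, ContDiff ℝ (⊤ : ℕ∞) (fun y => (Pb y).2.2 i) := fun i => by fun_prop
  have cq : ∀ i, HasCompactSupport (fun y => (Pb y).2.1 i) := fun i =>
    hPbc.comp_left (g := fun z : Mcs n => z.2.1 i) rfl
  have cp : ∀ i, HasCompactSupport (fun y => (Pb y).2.2 i) := fun i =>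
    hPbc.comp_left (g := fun z : Mcs n => z.2.2 i) rfl
  have A := fun i => ibp_aux H _ hH (hq i) (cq i) (eP n i)
  have B := fun i => ibp_aux H _ hH (hp i) (cp i) (eQ n i)
  have key : ∫ x : Mcs n, ∑ i, ((Pb x).2.1 i * pd H (eP n i) x - (Pb x).2.2 i * pd H (eQ n i) x)
      = ∫ x : Mcs n, H x * ∑ i, (fderiv ℝ (fun y => (Pb y).2.2 i) x (eQ n i)
          - fderiv ℝ (fun y => (Pb y).2.1 i) x (eP n i)) := by
    simp only [pd, Finset.mul_sum, mul_sub]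
    refine (integral_finsetSum _ (fun i _ => (A i).1.sub (B i).1)).trans
      (Eq.trans ?_ (integral_finsetSum _ (fun i _ => (B i).2.1.sub (A i).2.1)).symm)
    refine Finset.sum_congr rfl fun i _ => ?_
    simp only [Pi.sub_apply]
    rw [integral_sub (A i).1 (B i).1, integral_sub (B i).2.1 (A i).2.1, (A i).2.2, (B i).2.2]
    ring
  refine ⟨key, key.trans ?_⟩
  congr 1
  funext x
  have hn : ∀ i, fderiv ℝ (fun y => -(Pb y).2.1 i) x = - fderiv ℝ (fun y => (Pb y).2.1 i) x :=
    fun i => fderiv_fun_neg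
  simp only [divg, sharpCs, hn, Finset.sum_sub_distrib, neg_apply,
    Finset.sum_neg_distrib]
  ring
end
end

section
/- On ℝ^(2n+1) with coordinates (t, q^i, p_i), let Π̄ be a smooth one-form with components (Π̄_t, Π̄_i, Π̄^i) and H a smooth function. Define f(Π̄) = Σ_i (∂Π̄^i/∂q^i − ∂Π̄_i/∂p_i). Then f(L_{X^{cs}_H} Π̄) = {f(Π̄), H}^{cs}, where L_{X^{cs}_H} Π̄ is the Lie derivative of Π̄ along the cosymplectic Hamiltonian vector field. Consequently, if Π̄ solves the nonautonomous momentum-Vlasov equation ∂Π̄/∂s = −L_{X^{cs}_H} Π̄, then f = f(Π̄) solves the nonautonomous Vlasov equation ∂f/∂s = {H, f}^{cs}. -/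
noncomputable section

/-- The cosymplectic Poisson bracket
`{F,H}^{cs} = Σᵢ (∂F/∂qⁱ ∂H/∂pᵢ − ∂F/∂pᵢ ∂H/∂qⁱ)`. -/
def csBracket {n : ℕ} (F H : Mcs n → ℝ) : Mcs n → ℝ :=
  fun x => ∑ i, (pd F (eQ n i) x * pd H (eP n i) x - pd F (eP n i) x * pd H (eQ n i) x)

/-- The cosymplectic Hamiltonian vector field `X^{cs}_H`:
`t`-component `0`, `qⁱ`-component `∂H/∂pᵢ`, `pᵢ`-component `−∂H/∂qⁱ`. -/
def Xcs {n : ℕ} (H : Mcs n → ℝ) : Mcs n → Mcs n :=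
  fun x => (0, fun i => pd H (eP n i) x, fun i => - pd H (eQ n i) x)

/-- Pairing of a one-form with components `(α_t, α_i, αⁱ)` with a vector field value. -/
def pairM {n : ℕ} (α v : Mcs n) : ℝ :=
  α.1 * v.1 + (∑ i, α.2.1 i * v.2.1 i) + ∑ i, α.2.2 i * v.2.2 i

/-- The Lie derivative of a one-form `α` along a vector field `X`:
`(L_X α)_j = Σ_k (X^k ∂α_j/∂x^k + α_k ∂X^k/∂x^j)`. -/
def lieD {n : ℕ} (X : Mcs n → Mcs n) (α : Mcs n → Mcs n) : Mcs n → Mcs n :=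
  fun x =>
    (fderiv ℝ (fun y => (α y).1) x (X x)
        + fderiv ℝ (fun y => pairM (α x) (X y)) x (eT n),
     fun i => fderiv ℝ (fun y => (α y).2.1 i) x (X x)
        + fderiv ℝ (fun y => pairM (α x) (X y)) x (eQ n i),
     fun i => fderiv ℝ (fun y => (α y).2.2 i) x (X x)
        + fderiv ℝ (fun y => pairM (α x) (X y)) x (eP n i))

/-- The plasma density `f(Π̄) = Σᵢ (∂Π̄ⁱ/∂qⁱ − ∂Π̄_i/∂pᵢ)`. -/
def fdens {n : ℕ} (Pb : Mcs n → Mcs n) : Mcs n → ℝ :=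
  fun x => ∑ i, (fderiv ℝ (fun y => (Pb y).2.2 i) x (eQ n i)
      - fderiv ℝ (fun y => (Pb y).2.1 i) x (eP n i))

section helpers

variable {n : ℕ}

lemma pd_smooth {F : Mcs n → ℝ} (hF : ContDiff ℝ (⊤ : ℕ∞) F) (v : Mcs n) :
    ContDiff ℝ (⊤ : ℕ∞) (pd F v) := by
  have : ContDiff ℝ (⊤ : ℕ∞) (fderiv ℝ F) := hF.fderiv_right (by norm_cast)
  exact this.clm_apply contDiff_const

lemma smooth_da {E : Type*} [NormedAddCommGroup E] [NormedSpace ℝ E] {F : E → ℝ}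
    (hF : ContDiff ℝ (⊤ : ℕ∞) F) (x : E) :
    DifferentiableAt ℝ F x := hF.differentiable (by simp) x

lemma second_comm {E : Type*} [NormedAddCommGroup E] [NormedSpace ℝ E] {F : E → ℝ}
    (hF : ContDiff ℝ (⊤ : ℕ∞) F) (v w x : E) :
    fderiv ℝ (fun y => fderiv ℝ F y v) x w = fderiv ℝ (fun y => fderiv ℝ F y w) x v := by
  have h1 : ContDiff ℝ (⊤ : ℕ∞) (fderiv ℝ F) := hF.fderiv_right (by norm_cast)
  have h2 : DifferentiableAt ℝ (fderiv ℝ F) x := h1.differentiable (by simp) x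
  have hs : IsSymmSndFDerivAt ℝ F x :=
    hF.contDiffAt.isSymmSndFDerivAt (by
      simp only [minSmoothness_of_isRCLikeNormedField]; exact WithTop.coe_le_coe.2 (le_top : (2 : ℕ∞) ≤ ⊤))
  rw [fderiv_clm_apply h2 (differentiableAt_const _),
    fderiv_clm_apply h2 (differentiableAt_const _)]
  simpa using hs.eq w v

lemma pd_comm {F : Mcs n → ℝ} (hF : ContDiff ℝ (⊤ : ℕ∞) F) (v w x : Mcs n) :
    pd (pd F v) w x = pd (pd F w) v x := second_comm hF v w x

lemma pd_mul {F G : Mcs n → ℝ} (hF : ContDiff ℝ (⊤ : ℕ∞) F) (hG : ContDiff ℝ (⊤ : ℕ∞) G)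
    (v x : Mcs n) : pd (fun y => F y * G y) v x = pd F v x * G x + F x * pd G v x := by
  unfold pd
  rw [fderiv_fun_mul (smooth_da hF x) (smooth_da hG x)]
  simp; ring

lemma pd_add {F G : Mcs n → ℝ} (hF : ContDiff ℝ (⊤ : ℕ∞) F) (hG : ContDiff ℝ (⊤ : ℕ∞) G)
    (v x : Mcs n) : pd (fun y => F y + G y) v x = pd F v x + pd G v x := by
  unfold pd
  rw [fderiv_fun_add (smooth_da hF x) (smooth_da hG x)]
  simp

lemma pd_sub {F G : Mcs n → ℝ} (hF : ContDiff ℝ (⊤ : ℕ∞) F) (hG : ContDiff ℝ (⊤ : ℕ∞) G)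
    (v x : Mcs n) : pd (fun y => F y - G y) v x = pd F v x - pd G v x := by
  unfold pd
  rw [fderiv_fun_sub (smooth_da hF x) (smooth_da hG x)]
  simp

lemma pd_sum {F : Fin n → Mcs n → ℝ} (hF : ∀ k, ContDiff ℝ (⊤ : ℕ∞) (F k))
    (v x : Mcs n) : pd (fun y => ∑ k, F k y) v x = ∑ k, pd (F k) v x := by
  unfold pd
  rw [fderiv_fun_sum (fun k _ => smooth_da (hF k) x)]
  simp

lemma pd_const_mul {F : Mcs n → ℝ} (hF : ContDiff ℝ (⊤ : ℕ∞) F) (c : ℝ)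
    (v x : Mcs n) : pd (fun y => c * F y) v x = c * pd F v x := by
  unfold pd
  rw [fderiv_const_mul (smooth_da hF x)]
  simp

lemma Xcs_eq (H : Mcs n → ℝ) (x : Mcs n) :
    Xcs H x = ∑ k, (pd H (eP n k) x • eQ n k - pd H (eQ n k) x • eP n k) := by
  unfold Xcs eQ eP
  refine Prod.ext ?_ (Prod.ext ?_ ?_)
  · simp [Prod.fst_sum]
  · ext j
    simp [Prod.fst_sum, Prod.snd_sum, Finset.sum_apply, Pi.single_apply]
  · ext j
    simp [Prod.fst_sum, Prod.snd_sum, Finset.sum_apply, Pi.single_apply]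

lemma fderiv_Xcs (F H : Mcs n → ℝ) (x : Mcs n) :
    fderiv ℝ F x (Xcs H x) =
      ∑ k, (pd F (eQ n k) x * pd H (eP n k) x - pd F (eP n k) x * pd H (eQ n k) x) := by
  rw [Xcs_eq, map_sum]
  refine Finset.sum_congr rfl fun k _ => ?_
  simp [pd]; ring

lemma fderiv_pair {H : Mcs n → ℝ} (hH : ContDiff ℝ (⊤ : ℕ∞) H) (α x v : Mcs n) :
    fderiv ℝ (fun y => pairM α (Xcs H y)) x v =
      ∑ k, (α.2.1 k * pd (pd H (eP n k)) v x - α.2.2 k * pd (pd H (eQ n k)) v x) := by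
  have h1 : (fun y => pairM α (Xcs H y)) =
      fun y => ∑ k, (α.2.1 k * pd H (eP n k) y - α.2.2 k * pd H (eQ n k) y) := by
    ext y
    simp [pairM, Xcs, Finset.sum_sub_distrib, sub_eq_add_neg, Finset.sum_add_distrib]
  rw [h1]
  have hs := fun v => pd_smooth hH v
  change pd _ v x = _
  rw [pd_sum (fun k => (contDiff_const.mul (hs _)).sub (contDiff_const.mul (hs _)))]
  refine Finset.sum_congr rfl fun k _ => ?_
  rw [pd_sub (contDiff_const.mul (hs _)) (contDiff_const.mul (hs _)),
    pd_const_mul (hs _), pd_const_mul (hs _)]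

lemma comp_smooth1 {Pb : Mcs n → Mcs n} (hPb : ContDiff ℝ (⊤ : ℕ∞) Pb) (i : Fin n) :
    ContDiff ℝ (⊤ : ℕ∞) (fun y => (Pb y).2.1 i) := by fun_prop

lemma comp_smooth2 {Pb : Mcs n → Mcs n} (hPb : ContDiff ℝ (⊤ : ℕ∞) Pb) (i : Fin n) :
    ContDiff ℝ (⊤ : ℕ∞) (fun y => (Pb y).2.2 i) := by fun_prop

/-- Derivative of a component of the Lie derivative. -/
lemma pd_comp {H : Mcs n → ℝ} (hH : ContDiff ℝ (⊤ : ℕ∞) H) {c : Mcs n → ℝ}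
    (hc : ContDiff ℝ (⊤ : ℕ∞) c) {a b : Fin n → Mcs n → ℝ}
    (ha : ∀ k, ContDiff ℝ (⊤ : ℕ∞) (a k)) (hb : ∀ k, ContDiff ℝ (⊤ : ℕ∞) (b k))
    (v w x : Mcs n) :
    pd (fun y => (∑ k, (pd c (eQ n k) y * pd H (eP n k) y - pd c (eP n k) y * pd H (eQ n k) y))
      + ∑ k, (a k y * pd (pd H (eP n k)) v y - b k y * pd (pd H (eQ n k)) v y)) w x
    = ∑ k, (((pd (pd c (eQ n k)) w x * pd H (eP n k) x
          + pd c (eQ n k) x * pd (pd H (eP n k)) w x)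
        - (pd (pd c (eP n k)) w x * pd H (eQ n k) x
          + pd c (eP n k) x * pd (pd H (eQ n k)) w x))
      + ((pd (a k) w x * pd (pd H (eP n k)) v x
          + a k x * pd (pd (pd H (eP n k)) v) w x)
        - (pd (b k) w x * pd (pd H (eQ n k)) v x
          + b k x * pd (pd (pd H (eQ n k)) v) w x))) := by
  have hs := fun v => pd_smooth hH v
  have hss := fun v w => pd_smooth (hs v) w
  have hcs := fun v => pd_smooth hc v
  have A := fun k => ((hcs (eQ n k)).mul (hs (eP n k)))
  have B := fun k => ((hcs (eP n k)).mul (hs (eQ n k)))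
  have C := fun k => ((ha k).mul (hss (eP n k) v))
  have D := fun k => ((hb k).mul (hss (eQ n k) v))
  rw [pd_add (ContDiff.sum fun k _ => (A k).sub (B k)) (ContDiff.sum fun k _ => (C k).sub (D k)),
    pd_sum (fun k => (A k).sub (B k)), pd_sum (fun k => (C k).sub (D k)),
    ← Finset.sum_add_distrib]
  refine Finset.sum_congr rfl fun k _ => ?_
  rw [pd_sub (A k) (B k), pd_sub (C k) (D k), pd_mul (hcs _) (hs _), pd_mul (hcs _) (hs _),
    pd_mul (ha k) (hss _ _), pd_mul (hb k) (hss _ _)]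

lemma pd_fdens {Pb : Mcs n → Mcs n} (hPb : ContDiff ℝ (⊤ : ℕ∞) Pb) (v x : Mcs n) :
    pd (fdens Pb) v x = ∑ i, (pd (pd (fun y => (Pb y).2.2 i) (eQ n i)) v x
      - pd (pd (fun y => (Pb y).2.1 i) (eP n i)) v x) := by
  have A := fun i => pd_smooth (comp_smooth2 hPb i) (eQ n i)
  have B := fun i => pd_smooth (comp_smooth1 hPb i) (eP n i)
  change pd (fun x => ∑ i, (pd (fun y => (Pb y).2.2 i) (eQ n i) x
      - pd (fun y => (Pb y).2.1 i) (eP n i) x)) v x = _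
  rw [pd_sum (fun i => (A i).sub (B i))]
  exact Finset.sum_congr rfl fun i _ => pd_sub (A i) (B i) v x

lemma part_one {H : Mcs n → ℝ}
    (hH : ContDiff ℝ (⊤ : ℕ∞) H) {Pb : Mcs n → Mcs n} (hPb : ContDiff ℝ (⊤ : ℕ∞) Pb)
    (x : Mcs n) : fdens (lieD (Xcs H) Pb) x = csBracket (fdens Pb) H x := by
  have ha := comp_smooth1 hPb
  have hb := comp_smooth2 hPb
  have hs := fun v => pd_smooth hH v
  set a : Fin n → Mcs n → ℝ := fun i y => (Pb y).2.1 i with ha_def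
  set b : Fin n → Mcs n → ℝ := fun i y => (Pb y).2.2 i with hb_def
  have c2 : ∀ i, (fun y => (lieD (Xcs H) Pb y).2.2 i) = fun y =>
      (∑ k, (pd (b i) (eQ n k) y * pd H (eP n k) y - pd (b i) (eP n k) y * pd H (eQ n k) y))
      + ∑ k, (a k y * pd (pd H (eP n k)) (eP n i) y
        - b k y * pd (pd H (eQ n k)) (eP n i) y) := fun i => by
    funext y
    simp only [lieD]
    rw [fderiv_Xcs, fderiv_pair hH]
  have e2 := fun i => (congrArg (fun F => pd F (eQ n i) x) (c2 i)).trans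
    (pd_comp hH (hb i) ha hb (eP n i) (eQ n i) x)
  have c1 : ∀ i, (fun y => (lieD (Xcs H) Pb y).2.1 i) = fun y =>
      (∑ k, (pd (a i) (eQ n k) y * pd H (eP n k) y - pd (a i) (eP n k) y * pd H (eQ n k) y))
      + ∑ k, (a k y * pd (pd H (eP n k)) (eQ n i) y
        - b k y * pd (pd H (eQ n k)) (eQ n i) y) := fun i => by
    funext y
    simp only [lieD]
    rw [fderiv_Xcs, fderiv_pair hH]
  have e1 := fun i => (congrArg (fun F => pd F (eP n i) x) (c1 i)).trans
    (pd_comp hH (ha i) ha hb (eQ n i) (eP n i) x)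
  let S : Fin n → Fin n → ℝ := fun i k =>
    pd (b i) (eQ n k) x * pd (pd H (eP n k)) (eQ n i) x
    - pd (b i) (eP n k) x * pd (pd H (eQ n k)) (eQ n i) x
    - pd (a i) (eQ n k) x * pd (pd H (eP n k)) (eP n i) x
    + pd (a i) (eP n k) x * pd (pd H (eQ n k)) (eP n i) x
  let R : Fin n → Fin n → ℝ := fun i k =>
    (pd (pd (b i) (eQ n i)) (eQ n k) x - pd (pd (a i) (eP n i)) (eQ n k) x) * pd H (eP n k) x
    - (pd (pd (b i) (eQ n i)) (eP n k) x - pd (pd (a i) (eP n i)) (eP n k) x) * pd H (eQ n k) x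
  have hR : csBracket (fdens Pb) H x = ∑ i, ∑ k, R i k := by
    rw [Finset.sum_comm]
    unfold csBracket
    refine Finset.sum_congr rfl fun k _ => ?_
    rw [pd_fdens hPb, pd_fdens hPb, Finset.sum_mul, Finset.sum_mul, ← Finset.sum_sub_distrib]
  have hL : fdens (lieD (Xcs H) Pb) x = ∑ i, ∑ k, (R i k + (S i k - S k i)) := by
    unfold fdens
    refine Finset.sum_congr rfl fun i _ => ?_
    refine (congrArg₂ (fun u v : ℝ => u - v) (e2 i) (e1 i)).trans ?_
    rw [← Finset.sum_sub_distrib]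
    refine Finset.sum_congr rfl fun k _ => ?_
    simp only [R, S]
    rw [pd_comm (hb i) (eQ n k) (eQ n i), pd_comm (hb i) (eP n k) (eQ n i),
      pd_comm (ha i) (eQ n k) (eP n i), pd_comm (ha i) (eP n k) (eP n i),
      pd_comm (hs (eP n k)) (eP n i) (eQ n i), pd_comm (hs (eQ n k)) (eP n i) (eQ n i),
      pd_comm hH (eP n i) (eQ n k), pd_comm hH (eQ n i) (eQ n k),
      pd_comm hH (eP n i) (eP n k), pd_comm hH (eQ n i) (eP n k)]
    ring
  rw [hL, hR]
  simp only [Finset.sum_add_distrib, Finset.sum_sub_distrib]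
  rw [Finset.sum_comm (f := fun i k => S k i)]
  ring

lemma fderiv_slice {G : ℝ × Mcs n → ℝ} (hG : ContDiff ℝ (⊤ : ℕ∞) G) (s : ℝ) (x v : Mcs n) :
    fderiv ℝ (fun y => G (s, y)) x v = fderiv ℝ G (s, x) (0, v) := by
  have h := (smooth_da hG (s, x)).hasFDerivAt.comp x (hasFDerivAt_prodMk_right (𝕜 := ℝ) s x)
  have h' := h.fderiv
  simp only [Function.comp_def] at h'
  rw [h']
  simp

lemma deriv_slice {G : ℝ × Mcs n → ℝ} (hG : ContDiff ℝ (⊤ : ℕ∞) G) (s : ℝ) (x : Mcs n) :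
    HasDerivAt (fun u => G (u, x)) (fderiv ℝ G (s, x) (1, 0)) s := by
  have h := (smooth_da hG (s, x)).hasFDerivAt.comp s (hasFDerivAt_prodMk_left (𝕜 := ℝ) s x)
  simpa [Function.comp_def] using h.hasDerivAt

lemma mixed {G : ℝ × Mcs n → ℝ} (hG : ContDiff ℝ (⊤ : ℕ∞) G) (s : ℝ) (x v : Mcs n) :
    HasDerivAt (fun u => fderiv ℝ (fun y => G (u, y)) x v)
      (fderiv ℝ (fun y => deriv (fun u => G (u, y)) s) x v) s := by
  have hd : ContDiff ℝ (⊤ : ℕ∞) (fderiv ℝ G) := hG.fderiv_right (by norm_cast)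
  have h1 : ContDiff ℝ (⊤ : ℕ∞) (fun z => fderiv ℝ G z (0, v)) := hd.clm_apply contDiff_const
  have h2 : ContDiff ℝ (⊤ : ℕ∞) (fun z => fderiv ℝ G z (1, 0)) := hd.clm_apply contDiff_const
  simp only [fderiv_slice hG, (deriv_slice hG _ _).deriv]
  have e := fderiv_slice h2 s x v
  rw [e, second_comm hG]
  exact deriv_slice h1 s x

end helpers

/-- `f(L_{X^{cs}_H} Π̄) = {f(Π̄), H}^{cs}`; consequently any solution of the
nonautonomous momentum-Vlasov equation `∂Π̄/∂s = −L_{X^{cs}_H}Π̄` yields a solution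
`f = f(Π̄)` of the nonautonomous Vlasov equation `∂f/∂s = {H, f}^{cs}`. -/
theorem nonautonomous_momentum_Vlasov_to_Vlasov (n : ℕ) (H : Mcs n → ℝ)
    (hH : ContDiff ℝ (⊤ : ℕ∞) H) (Pb : Mcs n → Mcs n) (hPb : ContDiff ℝ (⊤ : ℕ∞) Pb) :
    (∀ x, fdens (lieD (Xcs H) Pb) x = csBracket (fdens Pb) H x)
  ∧ ∀ Pbt : ℝ → Mcs n → Mcs n,
      ContDiff ℝ (⊤ : ℕ∞) (fun sx : ℝ × Mcs n => Pbt sx.1 sx.2) →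
      (∀ s x, deriv (fun u => Pbt u x) s = - lieD (Xcs H) (Pbt s) x) →
      (∀ s x, deriv (fun u => fdens (Pbt u) x) s = csBracket H (fdens (Pbt s)) x) := by
  refine ⟨part_one hH hPb, fun Pbt hP hE s x => ?_⟩
  have hPs : ContDiff ℝ (⊤ : ℕ∞) (Pbt s) :=
    hP.comp (contDiff_const.prodMk contDiff_id)
  have hd : ∀ y, HasDerivAt (fun u => Pbt u y) (- lieD (Xcs H) (Pbt s) y) s := fun y => by
    rw [← hE s y]
    have h : ContDiff ℝ (⊤ : ℕ∞) (fun u => Pbt u y) :=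
      hP.comp (contDiff_id.prodMk contDiff_const)
    exact (h.differentiable (by simp) s).hasDerivAt
  have G1 : ∀ i, ContDiff ℝ (⊤ : ℕ∞) (fun z : ℝ × Mcs n => (Pbt z.1 z.2).2.1 i) :=
    fun i => contDiff_pi.1 hP.snd.fst i
  have G2 : ∀ i, ContDiff ℝ (⊤ : ℕ∞) (fun z : ℝ × Mcs n => (Pbt z.1 z.2).2.2 i) :=
    fun i => contDiff_pi.1 hP.snd.snd i
  have d1 : ∀ i, (fun y => deriv (fun u => (Pbt u y).2.1 i) s)
      = fun y => -(lieD (Xcs H) (Pbt s) y).2.1 i := fun i => by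
    funext y
    have h := hasDerivAt_pi.1 ((hd y).snd.fst) i
    exact h.deriv
  have d2 : ∀ i, (fun y => deriv (fun u => (Pbt u y).2.2 i) s)
      = fun y => -(lieD (Xcs H) (Pbt s) y).2.2 i := fun i => by
    funext y
    have h := hasDerivAt_pi.1 ((hd y).snd.snd) i
    exact h.deriv
  have key : HasDerivAt (fun u => fdens (Pbt u) x)
      (∑ i, (fderiv ℝ (fun y => deriv (fun u => (Pbt u y).2.2 i) s) x (eQ n i)
        - fderiv ℝ (fun y => deriv (fun u => (Pbt u y).2.1 i) s) x (eP n i))) s := by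
    unfold fdens
    exact HasDerivAt.fun_sum fun i _ => (mixed (G2 i) s x (eQ n i)).sub (mixed (G1 i) s x (eP n i))
  rw [key.deriv]
  have p := part_one hH hPs x
  have q : csBracket H (fdens (Pbt s)) x = - csBracket (fdens (Pbt s)) H x := by
    unfold csBracket
    rw [← Finset.sum_neg_distrib]
    exact Finset.sum_congr rfl fun i _ => by ring
  rw [q, ← p]
  unfold fdens
  rw [← Finset.sum_neg_distrib]
  refine Finset.sum_congr rfl fun i _ => ?_
  rw [d1, d2, fderiv_fun_neg, fderiv_fun_neg]
  simp only [_root_.neg_apply]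
  ring
end
end
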